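/- arXiv:math/0605294 — 2 statements merged into one kernel-verified Lean document; each statement's English description precedes it below -/
import Mathlib

section
/- Let G be a connected finite simple graph that has greatest spectral radius among all connected graphs with the same degree sequence π. Then there exists a BFD-ordering ≺ of the vertices of G that is consistent with the Perron vector f of G, in the sense that f(u) > f(v) implies u ≺ v (and hence, by property (B2), d(u) ≥ d(v)). -/
open Finset

variable {V : Type*} {W : Type*}

/-- The adjacency matrix of a finite simple graph, with real entries. -/
noncomputable def adjMat [Fintype V] (G : SimpleGraph V) : Matrix V V ℝ :=
  letI := Classical.decRel G.Adj
  G.adjMatrix ℝ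

/-- The spectral radius `λ(G)`: the largest eigenvalue of the adjacency matrix. -/
noncomputable def specRad [Fintype V] (G : SimpleGraph V) : ℝ :=
  sSup {μ : ℝ | ∃ f : V → ℝ, f ≠ 0 ∧ (adjMat G).mulVec f = μ • f}

/-- The degree of a vertex. -/
noncomputable def deg [Fintype V] (G : SimpleGraph V) (v : V) : ℕ :=
  letI := Classical.decRel G.Adj
  G.degree v

/-- The degree sequence of `G`, as a multiset. -/
noncomputable def degMultiset [Fintype V] (G : SimpleGraph V) : Multiset ℕ :=
  Finset.univ.val.map (deg G)

/-- `G` has the degree sequence `d` (a sequence of length `n`). -/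
def hasDegSeq [Fintype V] (G : SimpleGraph V) {n : ℕ} (d : Fin n → ℕ) : Prop :=
  Finset.univ.val.map d = degMultiset G

/-- `f` is the Perron vector of `G`: a positive unit eigenvector for the
largest eigenvalue. -/
def IsPerronVector [Fintype V] (G : SimpleGraph V) (f : V → ℝ) : Prop :=
  (∀ v, 0 < f v) ∧ (∑ v, f v ^ 2 = 1) ∧ (adjMat G).mulVec f = specRad G • f

/-- `N_f(v) = Σ_{u ∼ v} f(u)`. -/
noncomputable def Nf [Fintype V] (G : SimpleGraph V) (f : V → ℝ) (v : V) : ℝ :=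
  letI := Classical.decRel G.Adj
  ∑ u ∈ G.neighborFinset v, f u

/-- `w` is the parent of `v` w.r.t. the ordering `ord` (with root `ord.symm 0`):
`w` is the `ord`-least neighbor of `v` whose height is one less than that of `v`. -/
def IsParent [Fintype V] [Nonempty V] (G : SimpleGraph V)
    (ord : V ≃ Fin (Fintype.card V)) (w v : V) : Prop :=
  G.Adj w v ∧ G.dist (ord.symm ⟨0, Fintype.card_pos⟩) w + 1
      = G.dist (ord.symm ⟨0, Fintype.card_pos⟩) v ∧
    ∀ w' : V, G.Adj w' v →
      G.dist (ord.symm ⟨0, Fintype.card_pos⟩) w' + 1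
        = G.dist (ord.symm ⟨0, Fintype.card_pos⟩) v → ord w ≤ ord w'

/-- `ord` is a breadth-first search ordering with decreasing degrees (BFD-ordering):
vertices are listed layer by layer by distance from the root (the `ord`-least vertex),
(B1) children of earlier parents come before children of later parents, and
(B2) earlier vertices have larger or equal degrees. -/
def IsBFDOrdering [Fintype V] [Nonempty V] (G : SimpleGraph V)
    (ord : V ≃ Fin (Fintype.card V)) : Prop :=
  (∀ u v : V, ord u ≤ ord v →
      G.dist (ord.symm ⟨0, Fintype.card_pos⟩) u
        ≤ G.dist (ord.symm ⟨0, Fintype.card_pos⟩) v) ∧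
  (∀ w1 w2 v1 v2 : V, ord w1 < ord w2 →
      IsParent G ord w1 v1 → IsParent G ord w2 v2 → ord v1 < ord v2) ∧
  (∀ u v : V, ord u < ord v → deg G v ≤ deg G u)

/-- A tree degree sequence: non-increasing, positive entries, summing to `2(n-1)`. -/
def IsTreeDegSeq {n : ℕ} (d : Fin n → ℕ) : Prop :=
  Antitone d ∧ (∀ i, 0 < d i) ∧ ∑ i, d i = 2 * (n - 1)

/-- `Σ_{uv ∈ E(G)} f(u) f(v)`. -/
noncomputable def edgeSum [Fintype V] [DecidableEq V] (G : SimpleGraph V) (f : V → ℝ) : ℝ :=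
  letI := Classical.decRel G.Adj
  ∑ e ∈ G.edgeFinset, Sym2.lift ⟨fun u v => f u * f v, fun u v => mul_comm (f u) (f v)⟩ e

/-- The graph obtained from `G` by switching: replacing edges `v1u1`, `v2u2`
by `v1v2`, `u1u2`. -/
noncomputable def switched (G : SimpleGraph V) (v1 u1 v2 u2 : V) : SimpleGraph V :=
  SimpleGraph.fromEdgeSet ((G.edgeSet \ {s(v1, u1), s(v2, u2)}) ∪ {s(v1, v2), s(u1, u2)})

/-- The graph obtained from `G` by shifting: replacing the edge `uv1` by `uv2`. -/
noncomputable def shifted (G : SimpleGraph V) (u v1 v2 : V) : SimpleGraph V :=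
  SimpleGraph.fromEdgeSet ((G.edgeSet \ {s(u, v1)}) ∪ {s(u, v2)})


/-! ### The Rayleigh principle for the adjacency matrix -/

lemma adjMat_apply [Fintype V] (G : SimpleGraph V) (a b : V) [Decidable (G.Adj a b)] :
    adjMat G a b = if G.Adj a b then 1 else 0 := by
  classical
  simp only [adjMat, SimpleGraph.adjMatrix_apply]
  congr

lemma adjMat_isHermitian [Fintype V] (G : SimpleGraph V) : (adjMat G).IsHermitian := by
  classical
  ext a b
  simp [adjMat_apply, SimpleGraph.adj_comm]

lemma le_specRad [Fintype V] (G : SimpleGraph V) {μ : ℝ} {f : V → ℝ} (hf : f ≠ 0)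
    (h : (adjMat G).mulVec f = μ • f) : μ ≤ specRad G := by
  classical
  refine le_csSup (Set.Finite.bddAbove ?_) ⟨f, hf, h⟩
  refine (Module.End.finite_spectrum (Matrix.toLin' (adjMat G))).subset ?_
  rintro ν ⟨g, hg, hν⟩
  exact (Module.End.hasEigenvalue_of_hasEigenvector (x := g)
    (Module.End.hasEigenvector_iff.2 ⟨Module.End.mem_eigenspace_iff.2 hν, hg⟩)).mem_spectrum

lemma posSemidef_specRad_sub_adjMat [Fintype V] [DecidableEq V] (G : SimpleGraph V) :
    (specRad G • (1 : Matrix V V ℝ) - adjMat G).PosSemidef := by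
  have hM : (specRad G • (1 : Matrix V V ℝ) - adjMat G).IsHermitian := by
    refine Matrix.IsHermitian.sub ?_ (adjMat_isHermitian G)
    ext a b
    simp [Matrix.one_apply, eq_comm]
  refine hM.posSemidef_iff_eigenvalues_nonneg.2 fun i => ?_
  have h := hM.mulVec_eigenvectorBasis i
  have hne : (hM.eigenvectorBasis i : V → ℝ) ≠ 0 := by
    intro h0
    refine hM.eigenvectorBasis.toBasis.ne_zero i ?_
    ext a
    simpa using congrFun h0 a
  have := le_specRad G (μ := specRad G - hM.eigenvalues i) hne (by
    rw [Matrix.sub_mulVec, Matrix.smul_mulVec, Matrix.one_mulVec] at h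
    rw [sub_smul, ← h]
    abel)
  simpa using this

/-- If `H` has no greater spectral radius than `G`, then its quadratic form at the Perron vector
of `G` does not exceed that of `G`, unless the Perron vector is also an eigenvector of `H`. -/
lemma mulVec_eq_of_dotProduct_le [Fintype V] {G H : SimpleGraph V} {f : V → ℝ}
    (hf : IsPerronVector G f) (hle : specRad H ≤ specRad G)
    (h : f ⬝ᵥ (adjMat G).mulVec f ≤ f ⬝ᵥ (adjMat H).mulVec f) :
    (adjMat H).mulVec f = (adjMat G).mulVec f := by
  classical
  obtain ⟨-, hunit, hG⟩ := hf
  have hff : f ⬝ᵥ f = 1 := by simpa [dotProduct, sq] using hunit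
  have hpsd := posSemidef_specRad_sub_adjMat H
  have hexp : f ⬝ᵥ (specRad H • (1 : Matrix V V ℝ) - adjMat H).mulVec f
      = specRad H - f ⬝ᵥ (adjMat H).mulVec f := by
    rw [Matrix.sub_mulVec, Matrix.smul_mulVec, Matrix.one_mulVec, dotProduct_sub,
      dotProduct_smul, hff]
    simp
  have hnn := hpsd.dotProduct_mulVec_nonneg f
  have hzero := hpsd.dotProduct_mulVec_zero_iff f
  rw [star_trivial, hexp] at hnn hzero
  rw [hG, dotProduct_smul, hff, smul_eq_mul, mul_one] at h
  have hz := hzero.1 (by linarith)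
  rw [Matrix.sub_mulVec, Matrix.smul_mulVec, Matrix.one_mulVec, sub_eq_zero] at hz
  rw [← hz, hG, show specRad H = specRad G by linarith]

lemma deg_eq_mulVec [Fintype V] (G : SimpleGraph V) (v : V) :
    (deg G v : ℝ) = (adjMat G).mulVec 1 v := by
  classical
  simp only [deg, adjMat]
  rw [← Function.const_one, SimpleGraph.adjMatrix_mulVec_const_apply, mul_one]

/-! ### Exchanging neighbors between two vertices -/

/-- The graph obtained from `G` by exchanging the neighbors of `u` and `v` within `D`. -/
def exchange [DecidableEq V] (G : SimpleGraph V) (u v : V) (D : Finset V) : SimpleGraph V where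
  Adj a b := if a ∈ D ∨ b ∈ D then G.Adj (Equiv.swap u v a) (Equiv.swap u v b) else G.Adj a b
  symm := ⟨fun a b h => by
    by_cases hD : a ∈ D ∨ b ∈ D
    · rw [if_pos hD] at h
      rw [if_pos hD.symm]
      exact h.symm
    · rw [if_neg hD] at h
      rw [if_neg (fun h' => hD h'.symm)]
      exact h.symm⟩
  loopless := ⟨fun a h => by split_ifs at h <;> exact G.irrefl h⟩

/-- The change of the adjacency of `v` under `exchange`, up to sign that of `u`. -/
noncomputable def exchangeDiff [Fintype V] [DecidableEq V] (G : SimpleGraph V) (u v : V)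
    (D : Finset V) (b : V) : ℝ :=
  if b ∈ D then adjMat G v b - adjMat G u b else 0

section Exchange

variable [DecidableEq V] {G : SimpleGraph V} {u v : V} {D : Finset V}

lemma exchange_adj_of_mem (hu : u ∉ D) (hv : v ∉ D) {d : V} (hd : d ∈ D) :
    (exchange G u v D).Adj u d ↔ G.Adj v d := by
  have h1 : d ≠ u := by rintro rfl; exact hu hd
  have h2 : d ≠ v := by rintro rfl; exact hv hd
  simp [exchange, hd, Equiv.swap_apply_of_ne_of_ne h1 h2]

lemma exchange_adj_of_mem' (hu : u ∉ D) (hv : v ∉ D) {d : V} (hd : d ∈ D) :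
    (exchange G u v D).Adj v d ↔ G.Adj u d := by
  have h1 : d ≠ u := by rintro rfl; exact hu hd
  have h2 : d ≠ v := by rintro rfl; exact hv hd
  simp [exchange, hd, Equiv.swap_apply_of_ne_of_ne h1 h2]

lemma exchange_adj_of_forall_ne (hu : u ∉ D) (hv : v ∉ D) {a b : V} (h : G.Adj a b)
    (hne : ∀ d ∈ D, s(a, b) ≠ s(u, d) ∧ s(a, b) ≠ s(v, d)) : (exchange G u v D).Adj a b := by
  by_cases hD : a ∈ D ∨ b ∈ D
  · have hfix : ∀ c, c ≠ u → c ≠ v → Equiv.swap u v c = c := fun c =>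
      Equiv.swap_apply_of_ne_of_ne
    have ha : Equiv.swap u v a = a := by
      refine hfix a ?_ ?_ <;> rintro rfl
      · exact (hne b (hD.resolve_left hu)).1 rfl
      · exact (hne b (hD.resolve_left hv)).2 rfl
    have hb : Equiv.swap u v b = b := by
      refine hfix b ?_ ?_ <;> rintro rfl
      · exact (hne a (hD.resolve_right hu)).1 Sym2.eq_swap
      · exact (hne a (hD.resolve_right hv)).2 Sym2.eq_swap
    simpa [exchange, hD, ha, hb] using h
  · simpa [exchange, hD] using h

lemma exchange_reachable_of_walk (hu : u ∉ D) (hv : v ∉ D) {a b : V} (p : G.Walk a b)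
    (hp : ∀ d ∈ D, s(u, d) ∉ p.edges ∧ s(v, d) ∉ p.edges) : (exchange G u v D).Reachable a b := by
  refine ⟨p.transfer _ fun e he => ?_⟩
  induction e with
  | _ x y =>
    refine exchange_adj_of_forall_ne hu hv (p.adj_of_mem_edges he) fun d hd => ⟨?_, ?_⟩ <;> intro h
    · exact (hp d hd).1 (h ▸ he)
    · exact (hp d hd).2 (h ▸ he)

lemma exchange_reachable_of_close (hu : u ∉ D) (hv : v ∉ D)
    (hD : ∀ d ∈ D, ¬(G.Adj u d ∧ G.Adj v d))
    (h : G.Adj u v ∨ ∃ c, G.Adj u c ∧ G.Adj v c) : (exchange G u v D).Reachable u v := by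
  obtain h | ⟨c, huc, hvc⟩ := h
  · refine (exchange_adj_of_forall_ne hu hv h fun d hd => ⟨?_, ?_⟩).reachable <;> grind
  · have hc : c ∉ D := fun h => hD c h ⟨huc, hvc⟩
    have h1 : (exchange G u v D).Adj u c := by
      refine exchange_adj_of_forall_ne hu hv huc fun d hd => ⟨?_, ?_⟩ <;> grind
    have h2 : (exchange G u v D).Adj v c := by
      refine exchange_adj_of_forall_ne hu hv hvc fun d hd => ⟨?_, ?_⟩ <;> grind
    exact h1.reachable.trans h2.symm.reachable

lemma exchange_connected (hu : u ∉ D) (hv : v ∉ D) (hG : G.Connected)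
    (h : (exchange G u v D).Reachable u v) : (exchange G u v D).Connected := by
  set H := exchange G u v D
  have hud : ∀ d ∈ D, G.Adj u d → H.Reachable u d := fun d hd hadj =>
    h.trans ((exchange_adj_of_mem' hu hv hd).2 hadj).reachable
  have hvd : ∀ d ∈ D, G.Adj v d → H.Reachable v d := fun d hd hadj =>
    h.symm.trans ((exchange_adj_of_mem hu hv hd).2 hadj).reachable
  have hadj : ∀ a b, G.Adj a b → H.Reachable a b := by
    intro a b hab
    by_cases hne : ∀ d ∈ D, s(a, b) ≠ s(u, d) ∧ s(a, b) ≠ s(v, d)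
    · exact (exchange_adj_of_forall_ne hu hv hab hne).reachable
    · push Not at hne
      obtain ⟨d, hd, hne⟩ := hne
      by_cases he : s(a, b) = s(u, d)
      · obtain ⟨rfl, rfl⟩ | ⟨rfl, rfl⟩ := Sym2.eq_iff.1 he
        · exact hud _ hd hab
        · exact (hud _ hd hab.symm).symm
      · obtain ⟨rfl, rfl⟩ | ⟨rfl, rfl⟩ := Sym2.eq_iff.1 (hne he)
        · exact hvd _ hd hab
        · exact (hvd _ hd hab.symm).symm
  have := hG.nonempty
  refine ⟨fun a b => ?_⟩
  obtain ⟨p⟩ := hG.preconnected a b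
  induction p with
  | nil => rfl
  | cons hab _ ih => exact (hadj _ _ hab).trans ih

variable [Fintype V]

lemma adjMat_exchange (huv : u ≠ v) (hu : u ∉ D) (hv : v ∉ D) (a b : V) :
    adjMat (exchange G u v D) a b = adjMat G a b
      + (Pi.single u 1 - Pi.single v 1 : V → ℝ) a * exchangeDiff G u v D b
      + exchangeDiff G u v D a * (Pi.single u 1 - Pi.single v 1 : V → ℝ) b := by
  classical
  by_cases hau : a = u
  · subst hau
    by_cases hb : b ∈ D
    · have h1 : b ≠ a := by rintro rfl; exact hu hb
      have h2 : b ≠ v := by rintro rfl; exact hv hb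
      simp [adjMat_apply, exchange_adj_of_mem hu hv hb, exchangeDiff, hu, hb, huv, h1, h2]
    · simp [adjMat_apply, exchange, exchangeDiff, hu, hb]
  by_cases hav : a = v
  · subst hav
    by_cases hb : b ∈ D
    · have h1 : b ≠ u := by rintro rfl; exact hu hb
      have h2 : b ≠ a := by rintro rfl; exact hv hb
      simp [adjMat_apply, exchange_adj_of_mem' hu hv hb, exchangeDiff, hv, hb, huv.symm, h1, h2]
    · simp [adjMat_apply, exchange, exchangeDiff, hv, hb]
  by_cases hbu : b = u
  · subst hbu
    by_cases ha : a ∈ D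
    · simp [adjMat_apply, SimpleGraph.adj_comm _ a, exchange_adj_of_mem hu hv ha, exchangeDiff,
        ha, hu, huv, hau, hav]
    · simp [adjMat_apply, exchange, exchangeDiff, hu, ha]
  by_cases hbv : b = v
  · subst hbv
    by_cases ha : a ∈ D
    · simp [adjMat_apply, SimpleGraph.adj_comm _ a, exchange_adj_of_mem' hu hv ha, exchangeDiff,
        ha, hv, huv.symm, hau, hav]
    · simp [adjMat_apply, exchange, exchangeDiff, hv, ha]
  simp [adjMat_apply, exchange, Equiv.swap_apply_of_ne_of_ne, hau, hav, hbu, hbv]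

lemma adjMat_exchange_mulVec (huv : u ≠ v) (hu : u ∉ D) (hv : v ∉ D) (f : V → ℝ) (a : V) :
    (adjMat (exchange G u v D)).mulVec f a = (adjMat G).mulVec f a
      + (Pi.single u 1 - Pi.single v 1 : V → ℝ) a * (exchangeDiff G u v D ⬝ᵥ f)
      + exchangeDiff G u v D a * (f u - f v) := by
  simp only [Matrix.mulVec, dotProduct, adjMat_exchange huv hu hv, add_mul, sum_add_distrib,
    mul_assoc, ← mul_sum, Pi.sub_apply, sub_mul, mul_sub, sum_sub_distrib]
  simp [Pi.single_apply]

lemma dotProduct_adjMat_exchange (huv : u ≠ v) (hu : u ∉ D) (hv : v ∉ D) (f : V → ℝ) :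
    f ⬝ᵥ (adjMat (exchange G u v D)).mulVec f = f ⬝ᵥ (adjMat G).mulVec f
      + 2 * ((f u - f v) * (exchangeDiff G u v D ⬝ᵥ f)) := by
  have h : (adjMat (exchange G u v D)).mulVec f = (adjMat G).mulVec f
      + (exchangeDiff G u v D ⬝ᵥ f) • (Pi.single u 1 - Pi.single v 1)
      + (f u - f v) • exchangeDiff G u v D := by
    ext a
    rw [adjMat_exchange_mulVec huv hu hv]
    simp [mul_comm]
  rw [h, dotProduct_add, dotProduct_add, dotProduct_smul, dotProduct_smul, dotProduct_sub,
    dotProduct_single_one, dotProduct_single_one, dotProduct_comm f (exchangeDiff G u v D)]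
  simp only [smul_eq_mul]
  ring

lemma deg_exchange (huv : u ≠ v) (hu : u ∉ D) (hv : v ∉ D) (a : V) :
    (deg (exchange G u v D) a : ℝ) =
      deg G a + (Pi.single u 1 - Pi.single v 1 : V → ℝ) a * ∑ b, exchangeDiff G u v D b := by
  rw [deg_eq_mulVec, deg_eq_mulVec, adjMat_exchange_mulVec huv hu hv]
  simp [dotProduct]

lemma degMultiset_exchange_of_sum_eq_zero (huv : u ≠ v) (hu : u ∉ D) (hv : v ∉ D)
    (h : ∑ b, exchangeDiff G u v D b = 0) :
    degMultiset (exchange G u v D) = degMultiset G := by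
  unfold degMultiset
  congr 1
  ext a
  have := deg_exchange (G := G) huv hu hv a
  rw [h, mul_zero, add_zero] at this
  exact_mod_cast this

lemma degMultiset_exchange_of_sum_eq_sub (huv : u ≠ v) (hu : u ∉ D) (hv : v ∉ D)
    (h : ∑ b, exchangeDiff G u v D b = deg G v - deg G u) :
    degMultiset (exchange G u v D) = degMultiset G := by
  have key : deg (exchange G u v D) = deg G ∘ Equiv.swap u v := by
    ext a
    have := deg_exchange (G := G) huv hu hv a
    rw [h] at this
    rw [Function.comp_apply]
    by_cases hau : a = u
    · subst hau
      rw [Equiv.swap_apply_left]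
      have h' : (deg (exchange G a v D) a : ℝ) = deg G v := by simpa [huv] using this
      exact_mod_cast h'
    by_cases hav : a = v
    · subst hav
      rw [Equiv.swap_apply_right]
      have h' : (deg (exchange G u a D) a : ℝ) = deg G u := by simpa [huv.symm] using this
      exact_mod_cast h'
    · rw [Equiv.swap_apply_of_ne_of_ne hau hav]
      have h' : (deg (exchange G u v D) a : ℝ) = deg G a := by simpa [hau, hav] using this
      exact_mod_cast h'
  unfold degMultiset
  rw [key, ← Multiset.map_map]
  congr 1
  simp

/-- In a graph of greatest spectral radius, an exchange cannot move weight of the Perron vector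
from a vertex to one of larger value. -/
lemma exchange_rigid {f : V → ℝ}
    (hmax : ∀ H : SimpleGraph V, H.Connected → degMultiset H = degMultiset G →
      specRad H ≤ specRad G)
    (hf : IsPerronVector G f) (huv : u ≠ v) (hu : u ∉ D) (hv : v ∉ D)
    (hconn : (exchange G u v D).Connected)
    (hdeg : degMultiset (exchange G u v D) = degMultiset G)
    (hle : f u ≤ f v) (hsum : exchangeDiff G u v D ⬝ᵥ f ≤ 0) :
    exchangeDiff G u v D ⬝ᵥ f = 0 ∧ ∀ b, exchangeDiff G u v D b * (f u - f v) = 0 := by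
  have heq := mulVec_eq_of_dotProduct_le hf (hmax _ hconn hdeg) (by
    rw [dotProduct_adjMat_exchange huv hu hv]
    nlinarith [mul_nonneg_of_nonpos_of_nonpos (sub_nonpos.2 hle) hsum])
  have hzero : exchangeDiff G u v D ⬝ᵥ f = 0 := by
    have := adjMat_exchange_mulVec (G := G) huv hu hv f u
    rw [heq] at this
    simpa [huv, exchangeDiff, hu] using this
  refine ⟨hzero, fun b => ?_⟩
  have := adjMat_exchange_mulVec (G := G) huv hu hv f b
  rw [heq, hzero, mul_zero, add_zero] at this
  linarith

end Exchange

/-! ### Degrees and neighbors in graphs of greatest spectral radius -/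

lemma card_sdiff_neighborFinset_add_deg [Fintype V] [DecidableEq V] (G : SimpleGraph V)
    [DecidableRel G.Adj] (u v : V) :
    #((G.neighborFinset u \ G.neighborFinset v).erase v) + deg G v
      = #((G.neighborFinset v \ G.neighborFinset u).erase u) + deg G u := by
  have hdeg : ∀ a, deg G a = #(G.neighborFinset a) := fun a => by
    rw [SimpleGraph.card_neighborFinset_eq_degree, deg]
    congr!
  have h1 := card_sdiff_add_card_inter (G.neighborFinset u) (G.neighborFinset v)
  have h2 := card_sdiff_add_card_inter (G.neighborFinset v) (G.neighborFinset u)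
  rw [inter_comm] at h2
  rw [hdeg, hdeg]
  by_cases h : G.Adj u v
  · have hv : v ∈ G.neighborFinset u \ G.neighborFinset v := by simpa using h
    have hu : u ∈ G.neighborFinset v \ G.neighborFinset u := by simpa using h.symm
    have h3 := card_erase_add_one hv
    have h4 := card_erase_add_one hu
    omega
  · rw [erase_eq_of_notMem (by simpa using h),
      erase_eq_of_notMem (by simpa using fun h' : G.Adj v u => h h'.symm)]
    omega

/-- In a graph of greatest spectral radius, the degree is monotone in the Perron vector. -/
lemma deg_le_deg_of_le [Fintype V] [DecidableEq V] {G : SimpleGraph V} (hconn : G.Connected)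
    (hmax : ∀ H : SimpleGraph V, H.Connected → degMultiset H = degMultiset G →
      specRad H ≤ specRad G)
    {f : V → ℝ} (hf : IsPerronVector G f) {u v : V} (hle : f u ≤ f v) : deg G u ≤ deg G v := by
  classical
  by_contra! hlt
  have huv : u ≠ v := by rintro rfl; exact lt_irrefl _ hlt
  have hcard := card_sdiff_neighborFinset_add_deg G u v
  set A := (G.neighborFinset u \ G.neighborFinset v).erase v with hA
  have memA : ∀ {d}, d ∈ A ↔ d ≠ v ∧ G.Adj u d ∧ ¬G.Adj v d := by simp [hA]
  obtain ⟨S, hSA, hScard, hreach⟩ : ∃ S ⊆ A, #S = deg G u - deg G v ∧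
      (exchange G u v S).Reachable u v := by
    have hno : ∀ S ⊆ A, u ∉ S ∧ v ∉ S ∧ ∀ d ∈ S, ¬(G.Adj u d ∧ G.Adj v d) := fun S hS =>
      ⟨fun h => G.irrefl (memA.1 (hS h)).2.1, fun h => (memA.1 (hS h)).1 rfl,
        fun d hd h => (memA.1 (hS hd)).2.2 h.2⟩
    by_cases hclose : G.Adj u v ∨ ∃ c, G.Adj u c ∧ G.Adj v c
    · obtain ⟨S, hSA, hScard⟩ := exists_subset_card_eq (s := A) (n := deg G u - deg G v) (by omega)
      obtain ⟨h1, h2, h3⟩ := hno S hSA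
      exact ⟨S, hSA, hScard, exchange_reachable_of_close h1 h2 h3 hclose⟩
    · push Not at hclose
      obtain ⟨p, hp⟩ := hconn.exists_isPath u v
      have hnil : ¬p.Nil := SimpleGraph.Walk.not_nil_of_ne huv
      have hpos : 0 < #((G.neighborFinset v \ G.neighborFinset u).erase u) := by
        refine card_pos.2 ⟨p.penultimate, ?_⟩
        have hz := (p.adj_penultimate hnil).symm
        simp only [mem_erase, mem_sdiff, SimpleGraph.mem_neighborFinset]
        exact ⟨fun h => hclose.1 (h ▸ hz).symm, hz, fun h => hclose.2 _ h hz⟩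
      obtain ⟨S, hSA, hScard⟩ := exists_subset_card_eq (s := A.erase p.snd)
        (n := deg G u - deg G v) (by have := pred_card_le_card_erase (s := A) (a := p.snd); omega)
      have hSA' := hSA.trans (erase_subset _ _)
      obtain ⟨h1, h2, -⟩ := hno S hSA'
      refine ⟨S, hSA', hScard, exchange_reachable_of_walk h1 h2 p fun d hd => ⟨fun h => ?_, fun h =>
        (memA.1 (hSA' hd)).2.2 (p.adj_of_mem_edges h)⟩⟩
      exact (mem_erase.1 (hSA hd)).1 (hp.eq_snd_of_mem_edges h)
  have huS : u ∉ S := fun h => G.irrefl (memA.1 (hSA h)).2.1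
  have hvS : v ∉ S := fun h => (memA.1 (hSA h)).1 rfl
  have hdiff : ∀ b, exchangeDiff G u v S b = if b ∈ S then -1 else 0 := fun b => by
    by_cases hb : b ∈ S
    · obtain ⟨-, h1, h2⟩ := memA.1 (hSA hb)
      simp [exchangeDiff, hb, adjMat_apply, h1, h2]
    · simp [exchangeDiff, hb]
  have hdot : exchangeDiff G u v S ⬝ᵥ f = -∑ b ∈ S, f b := by
    simp [dotProduct, hdiff, Finset.sum_ite_mem]
  have hpos : 0 < ∑ b ∈ S, f b :=
    sum_pos (fun b _ => hf.1 b) (card_pos.1 (by omega))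
  have := (exchange_rigid hmax hf huv huS hvS (exchange_connected huS hvS hconn hreach)
    (degMultiset_exchange_of_sum_eq_sub huv huS hvS (by
      simp [hdiff, hScard, Nat.cast_sub hlt.le])) hle (by linarith)).1
  linarith

/-- If `v` has at least the degree of `u`, then any private neighbor `w` of `u` can be exchanged
for some private neighbor of `v` without disconnecting the graph. -/
lemma exists_exchange_connected [Fintype V] [DecidableEq V] {G : SimpleGraph V}
    (hconn : G.Connected) {u v w : V} (hdeg : deg G u ≤ deg G v) (huw : G.Adj u w)
    (hvw : ¬G.Adj v w) (hwv : w ≠ v) :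
    ∃ x, G.Adj v x ∧ ¬G.Adj u x ∧ x ≠ u ∧ (exchange G u v {w, x}).Connected := by
  classical
  have hcard := card_sdiff_neighborFinset_add_deg G u v
  set A := (G.neighborFinset u \ G.neighborFinset v).erase v with hA
  set B := (G.neighborFinset v \ G.neighborFinset u).erase u with hB
  have memA : ∀ {d}, d ∈ A ↔ d ≠ v ∧ G.Adj u d ∧ ¬G.Adj v d := by simp [hA]
  have memB : ∀ {d}, d ∈ B ↔ d ≠ u ∧ G.Adj v d ∧ ¬G.Adj u d := by simp [hB]
  have hwA : w ∈ A := memA.2 ⟨hwv, huw, hvw⟩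
  suffices ∃ x ∈ B, (exchange G u v {w, x}).Reachable u v by
    obtain ⟨x, hx, hr⟩ := this
    obtain ⟨h1, h2, h3⟩ := memB.1 hx
    refine ⟨x, h2, h3, h1, exchange_connected ?_ ?_ hconn hr⟩
    · simp [huw.ne, h1.symm]
    · simp [hwv.symm, h2.ne]
  have hno : ∀ x ∈ B, u ∉ ({w, x} : Finset V) ∧ v ∉ ({w, x} : Finset V) := fun x hx => by
    obtain ⟨h1, h2, h3⟩ := memB.1 hx
    simp [huw.ne, h1.symm, hwv.symm, h2.ne]
  by_cases hclose : G.Adj u v ∨ ∃ c, G.Adj u c ∧ G.Adj v c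
  · obtain ⟨x, hx⟩ : B.Nonempty := card_pos.1 (by have := card_pos.2 ⟨w, hwA⟩; omega)
    refine ⟨x, hx, exchange_reachable_of_close (hno x hx).1 (hno x hx).2 ?_ hclose⟩
    simp [hvw, (memB.1 hx).2.2]
  push Not at hclose
  have huv : u ≠ v := by rintro rfl; exact hvw huw
  by_cases hr : (G.deleteEdges {s(u, w)}).Reachable u v
  · obtain ⟨p, hp⟩ := hr.exists_isPath
    have hnil : ¬p.Nil := SimpleGraph.Walk.not_nil_of_ne huv
    obtain ⟨hc, hcw⟩ : G.Adj u p.snd ∧ p.snd ≠ w := by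
      have := p.adj_snd hnil
      rw [SimpleGraph.deleteEdges_adj] at this
      exact ⟨this.1, fun h => this.2 (by simp [h])⟩
    have hcA : p.snd ∈ A :=
      memA.2 ⟨fun h => hclose.1 (h ▸ hc), hc, hclose.2 _ hc⟩
    have hA2 : 1 < #A := one_lt_card.2 ⟨_, hcA, _, hwA, hcw⟩
    obtain ⟨x, hx, hxz⟩ := exists_mem_ne (s := B) (by omega) p.penultimate
    refine ⟨x, hx, exchange_reachable_of_walk (hno x hx).1 (hno x hx).2
      (p.mapLe (SimpleGraph.deleteEdges_le _)) fun d hd => ?_⟩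
    rw [SimpleGraph.Walk.edges_mapLe_eq_edges]
    obtain rfl | rfl : d = w ∨ d = x := by simpa using hd
    · refine ⟨fun h => ?_, fun h => ?_⟩
      · have := p.adj_of_mem_edges h
        simp at this
      · exact hvw (SimpleGraph.deleteEdges_le _ (p.adj_of_mem_edges h))
    · refine ⟨fun h => ?_, fun h => ?_⟩
      · exact (memB.1 hx).2.2 (SimpleGraph.deleteEdges_le _ (p.adj_of_mem_edges h))
      · exact hxz (hp.eq_penultimate_of_mem_edges (by simpa only [Sym2.eq_swap] using h))
  · obtain ⟨q, hq⟩ := hconn.exists_isPath v w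
    have huq : u ∉ q.support := by
      intro hu
      refine hr (SimpleGraph.Reachable.symm ⟨(q.takeUntil u hu).transfer _ fun e he => ?_⟩)
      rw [SimpleGraph.edgeSet_deleteEdges]
      refine ⟨(q.takeUntil u hu).edges_subset_edgeSet he, ?_⟩
      rintro rfl
      exact SimpleGraph.Walk.endpoint_notMem_support_takeUntil hq hu huw.ne'
        ((q.takeUntil u hu).snd_mem_support_of_mem_edges he)
    cases q with
    | nil => exact absurd rfl hwv
    | @cons _ x _ hvx q =>
      rw [SimpleGraph.Walk.cons_isPath_iff] at hq
      rw [SimpleGraph.Walk.support_cons, List.mem_cons, not_or] at huq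
      have hxB : x ∈ B := by
        refine memB.2 ⟨?_, hvx, fun h => hclose.2 _ h hvx⟩
        rintro rfl
        exact huq.2 q.start_mem_support
      obtain ⟨hu, hv⟩ := hno x hxB
      have hwD : w ∈ ({w, x} : Finset V) := by simp
      have hxD : x ∈ ({w, x} : Finset V) := by simp
      refine ⟨x, hxB, ((exchange_adj_of_mem hu hv hxD).2 hvx).reachable.trans
        (SimpleGraph.Reachable.trans ?_ ((exchange_adj_of_mem' hu hv hwD).2 huw).symm.reachable)⟩
      exact exchange_reachable_of_walk hu hv q fun d _ =>
        ⟨fun h => huq.2 (q.fst_mem_support_of_mem_edges h),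
          fun h => hq.2 (q.fst_mem_support_of_mem_edges h)⟩

/-- In a graph of greatest spectral radius, if `f u < f v` for the Perron vector `f`, then `v` has
a neighbor of larger value than any given private neighbor of `u`. -/
lemma exists_adj_lt_of_lt [Fintype V] [DecidableEq V] {G : SimpleGraph V} (hconn : G.Connected)
    (hmax : ∀ H : SimpleGraph V, H.Connected → degMultiset H = degMultiset G →
      specRad H ≤ specRad G)
    {f : V → ℝ} (hf : IsPerronVector G f) {u v w : V} (hlt : f u < f v) (huw : G.Adj u w)
    (hvw : ¬G.Adj v w) (hwv : w ≠ v) : ∃ x, G.Adj v x ∧ f w < f x := by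
  classical
  by_contra! hle
  obtain ⟨x, hvx, hux, hxu, hH⟩ := exists_exchange_connected hconn
    (deg_le_deg_of_le hconn hmax hf hlt.le) huw hvw hwv
  have huv : u ≠ v := by rintro rfl; exact hvw huw
  have hwx : w ≠ x := by rintro rfl; exact hvw hvx
  have hdiff : exchangeDiff G u v {w, x} = Pi.single x 1 - Pi.single w 1 := by
    ext b
    by_cases hbw : b = w
    · subst hbw
      simp [exchangeDiff, adjMat_apply, huw, hvw, hwx]
    by_cases hbx : b = x
    · subst hbx
      simp [exchangeDiff, adjMat_apply, hux, hvx, hbw]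
    · simp [exchangeDiff, hbw, hbx]
  have := (exchange_rigid hmax hf huv (by simp [huw.ne, hxu.symm]) (by simp [hwv.symm, hvx.ne]) hH
    (degMultiset_exchange_of_sum_eq_zero huv (by simp [huw.ne, hxu.symm])
      (by simp [hwv.symm, hvx.ne]) (by simp [hdiff])) hlt.le
    (by simpa [hdiff, sub_dotProduct] using hle x hvx)).2 w
  rw [hdiff] at this
  exact hlt.ne' (by simpa [hwx, sub_eq_zero] using this)

/-! ### Breadth-first search orderings -/

lemma exists_equiv_fin_lt_iff [Fintype V] {α : Type*} [LinearOrder α] {k : V → α}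
    (hk : Function.Injective k) :
    ∃ ord : V ≃ Fin (Fintype.card V), ∀ u v, ord u < ord v ↔ k u < k v := by
  let _ := LinearOrder.lift' k hk
  exact ⟨(Fintype.orderIsoFinOfCardEq V rfl).symm.toEquiv,
    fun u v => (Fintype.orderIsoFinOfCardEq V rfl).symm.lt_iff_lt⟩

/-- The sorting key of a vertex `v` at distance `k` from `r`: vertices are sorted by the least key
of a neighbor at distance `k - 1`, and then by `e`, which takes values below `n`. -/
noncomputable def bfsKey (G : SimpleGraph V) (r : V) (e : V → ℕ) (n : ℕ) : ℕ → V → ℕ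
  | 0, _ => 0
  | k + 1, v => sInf (bfsKey G r e n k '' {w | G.Adj w v ∧ G.dist r w = k}) * n + e v

lemma exists_adj_dist_add_one {G : SimpleGraph V} (hconn : G.Connected) {r v : V} (hv : v ≠ r) :
    ∃ w, G.Adj w v ∧ G.dist r w + 1 = G.dist r v := by
  obtain ⟨p, hp⟩ := hconn.exists_walk_length_eq_dist r v
  have hnil : ¬p.Nil := SimpleGraph.Walk.not_nil_of_ne hv.symm
  have hadj := p.adj_penultimate hnil
  refine ⟨p.penultimate, hadj, ?_⟩
  have h1 := SimpleGraph.dist_le p.dropLast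
  have h2 := hadj.diff_dist_adj (u := r)
  have h3 : p.dropLast.length + 1 = p.length := by simpa using p.length_dropLast_add_one hnil
  omega

/-- Every connected graph has a breadth-first search ordering with a given root, in which children
of the same parent are sorted by decreasing values of a given function. -/
lemma exists_bfs_ordering [Fintype V] [Nonempty V] {G : SimpleGraph V} (hconn : G.Connected)
    (f : V → ℝ) (r : V) :
    ∃ ord : V ≃ Fin (Fintype.card V), ord.symm ⟨0, Fintype.card_pos⟩ = r ∧
      (∀ u v, ord u ≤ ord v → G.dist r u ≤ G.dist r v) ∧
      (∀ w1 w2 v1 v2, ord w1 < ord w2 → IsParent G ord w1 v1 → IsParent G ord w2 v2 →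
        ord v1 < ord v2) ∧
      (∀ w u v, IsParent G ord w u → IsParent G ord w v → ord u < ord v → f v ≤ f u) ∧
      ∀ v ≠ r, ∃ w, IsParent G ord w v := by
  classical
  obtain ⟨e, he⟩ := exists_equiv_fin_lt_iff (V := V)
    (k := fun v => toLex (-f v, Fintype.equivFin V v))
    (fun u v h => (Fintype.equivFin V).injective (congrArg (fun x => (ofLex x).2) h))
  set K : ℕ → V → ℕ := bfsKey G r (fun v => e v) (Fintype.card V) with hK
  have hn : 0 < Fintype.card V := Fintype.card_pos
  obtain ⟨ord, hord⟩ := exists_equiv_fin_lt_iff (V := V)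
    (k := fun v => toLex (G.dist r v, K (G.dist r v) v)) (by
      intro u v h
      obtain ⟨h1, h2⟩ : G.dist r u = G.dist r v ∧ K (G.dist r u) u = K (G.dist r v) v := by
        simpa using h
      rw [← h1] at h2
      cases hd : G.dist r u with
      | zero =>
        exact (hconn.dist_eq_zero_iff.1 hd).symm.trans (hconn.dist_eq_zero_iff.1 (h1 ▸ hd))
      | succ k =>
        rw [hd] at h2
        have h3 := congrArg (· % Fintype.card V) h2
        simp only [hK, bfsKey, Nat.mul_add_mod', Nat.mod_eq_of_lt (e _).2] at h3
        exact e.injective (Fin.ext h3))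
  simp only [Prod.Lex.toLex_lt_toLex] at hord
  have hroot : ord.symm ⟨0, Fintype.card_pos⟩ = r := by
    rw [Equiv.symm_apply_eq]
    by_contra hne
    have hlt : ord (ord.symm ⟨0, hn⟩) < ord r := by
      rw [Equiv.apply_symm_apply]
      exact lt_of_le_of_ne (Fin.mk_le_of_le_val (Nat.zero_le _)) hne
    rw [hord] at hlt
    rw [SimpleGraph.dist_self] at hlt
    obtain h | ⟨-, h⟩ := hlt
    · exact Nat.not_lt_zero _ h
    · exact Nat.not_lt_zero _ h
  have hlayer : ∀ u v, ord u ≤ ord v → G.dist r u ≤ G.dist r v := by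
    intro u v h
    by_contra! hlt
    exact absurd ((hord v u).2 (Or.inl hlt)) (not_lt.2 h)
  have hkey : ∀ w v, IsParent G ord w v →
      G.dist r w + 1 = G.dist r v ∧ K (G.dist r v) v = K (G.dist r w) w * Fintype.card V + e v := by
    rintro w v ⟨hadj, hdist, hmin⟩
    rw [hroot] at hdist hmin
    refine ⟨hdist, ?_⟩
    rw [← hdist, hK, bfsKey]
    congr 2
    refine IsLeast.csInf_eq ⟨⟨w, ⟨hadj, rfl⟩, rfl⟩, ?_⟩
    rintro _ ⟨w', ⟨hadj', hd'⟩, rfl⟩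
    by_contra! hlt
    refine absurd ((hord w' w).2 (Or.inr ⟨hd', ?_⟩)) (not_lt.2 (hmin w' hadj' (hd' ▸ hdist)))
    rw [hd']
    exact hlt
  refine ⟨ord, hroot, hlayer, ?_, ?_, ?_⟩
  · intro w1 w2 v1 v2 hlt h1 h2
    obtain ⟨hd1, hk1⟩ := hkey _ _ h1
    obtain ⟨hd2, hk2⟩ := hkey _ _ h2
    rw [hord] at hlt ⊢
    obtain hlt | ⟨heq, hlt⟩ := hlt
    · left; omega
    · refine Or.inr ⟨by omega, ?_⟩
      rw [hk1, hk2]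
      have := Nat.mul_le_mul_right (Fintype.card V) (Nat.succ_le_of_lt hlt)
      rw [Nat.succ_mul] at this
      have := (e v1).2
      omega
  · intro w u v hu hv hlt
    obtain ⟨hd1, hk1⟩ := hkey _ _ hu
    obtain ⟨hd2, hk2⟩ := hkey _ _ hv
    rw [hord] at hlt
    have hlt' : e u < e v := by
      obtain hlt | ⟨heq, hlt⟩ := hlt
      · omega
      · rw [hk1, hk2] at hlt
        exact Fin.lt_def.2 (by omega)
    rw [he, Prod.Lex.toLex_lt_toLex] at hlt'
    obtain h | h := hlt'
    · simp at h; exact h.le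
    · simp at h; exact h.1.ge
  · intro v hv
    obtain ⟨w, hw, hmin⟩ := (univ.filter fun w => G.Adj w v ∧ G.dist r w + 1 = G.dist r v)
      |>.exists_min_image ord (by
        obtain ⟨w, hw⟩ := exists_adj_dist_add_one hconn hv
        exact ⟨w, by simpa using hw⟩)
    simp only [mem_filter, mem_univ, true_and] at hw hmin
    refine ⟨w, hw.1, ?_⟩
    rw [hroot]
    exact ⟨hw.2, fun w' h1 h2 => hmin w' ⟨h1, h2⟩⟩

/-- In a breadth-first search ordering, the parent is the least neighbor. -/
lemma IsParent.le_of_adj [Fintype V] [Nonempty V] {G : SimpleGraph V}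
    {ord : V ≃ Fin (Fintype.card V)}
    (hlayer : ∀ u v, ord u ≤ ord v → G.dist (ord.symm ⟨0, Fintype.card_pos⟩) u
      ≤ G.dist (ord.symm ⟨0, Fintype.card_pos⟩) v)
    {w v x : V} (h : IsParent G ord w v) (hx : G.Adj v x) : ord w ≤ ord x := by
  obtain ⟨-, hdist, hmin⟩ := h
  by_contra! hlt
  have h1 := hlayer _ _ hlt.le
  have h2 := hx.diff_dist_adj (u := ord.symm ⟨0, Fintype.card_pos⟩)
  exact absurd (hmin x hx.symm (by omega)) (not_le.2 hlt)

/-- If a connected graph `G` has greatest spectral radius among all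
connected graphs with its degree sequence, then there is a BFD-ordering of its
vertices consistent with its Perron vector `f`: `f(u) > f(v)` implies `u ≺ v`. -/
theorem bfd_of_max_spectral_radius [Fintype V] [DecidableEq V] [Nonempty V]
    (G : SimpleGraph V) (hconn : G.Connected)
    (hmax : ∀ H : SimpleGraph V, H.Connected → degMultiset H = degMultiset G →
      specRad H ≤ specRad G)
    (f : V → ℝ) (hf : IsPerronVector G f) :
    ∃ ord : V ≃ Fin (Fintype.card V), IsBFDOrdering G ord ∧
      ∀ u v : V, f v < f u → ord u < ord v := by
  obtain ⟨r, hr⟩ := Finite.exists_max f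
  obtain ⟨ord, hroot, hlayer, hB1, htie, hpar⟩ := exists_bfs_ordering hconn f r
  have hmono : ∀ u v, ord u < ord v → f v ≤ f u := by
    intro u
    induction hu : ord u using WellFoundedLT.induction generalizing u with
    | ind i ih =>
      subst hu
      intro v huv
      by_cases hur : u = r
      · exact hur ▸ hr v
      have hvr : v ≠ r := by
        rintro rfl
        rw [← hroot, Equiv.apply_symm_apply] at huv
        exact absurd huv (not_lt.2 (Fin.mk_le_of_le_val (Nat.zero_le _)))
      obtain ⟨w1, hw1⟩ := hpar u hur
      obtain ⟨w2, hw2⟩ := hpar v hvr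
      obtain h | h | h := lt_trichotomy (ord w1) (ord w2)
      · have hw1u : ord w1 < ord u := by
          by_contra! hle
          have := hlayer _ _ hle
          have := hw1.2.1
          rw [hroot] at this
          omega
        have hlt : ∀ x, G.Adj v x → ord w1 < ord x := fun x hx =>
          h.trans_le (hw2.le_of_adj (by rwa [hroot]) hx)
        by_contra! hf'
        obtain ⟨x, hx, hfx⟩ := exists_adj_lt_of_lt hconn hmax hf hf' hw1.1.symm
          (fun hadj => lt_irrefl _ (hlt w1 hadj)) (by rintro rfl; exact lt_asymm hw1u huv)
        exact absurd (ih _ hw1u w1 rfl x (hlt x hx)) (not_le.2 hfx)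
      · obtain rfl := ord.injective h
        exact htie _ _ _ hw1 hw2 huv
      · exact absurd (hB1 _ _ _ _ h hw2 hw1) (lt_asymm huv)
  refine ⟨ord, ⟨by rwa [hroot], hB1, fun u v huv => deg_le_deg_of_le hconn hmax hf (hmono u v huv)⟩,
    fun u v hlt => ?_⟩
  by_contra! hle
  obtain h | h := hle.lt_or_eq
  · exact absurd (hmono v u h) (not_le.2 hlt)
  · exact hlt.ne (by rw [ord.injective h])
end

section
/- Any two trees with the same degree sequence π that both admit a BFD-ordering of their vertices are isomorphic as graphs. In other words, the BFD-tree with a given tree degree sequence is uniquely determined up to isomorphism. -/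
open Finset

variable {V : Type*} {W : Type*}

theorem Monotone.eq_of_map_univ_eq {α : Type*} [LinearOrder α] {n : ℕ} {f g : Fin n → α}
    (hf : Monotone f) (hg : Monotone g)
    (h : Finset.univ.val.map f = Finset.univ.val.map g) : f = g := by
  rw [Fin.univ_val_map, Fin.univ_val_map, Multiset.coe_eq_coe] at h
  exact List.ofFn_injective
    (h.eq_of_sortedLE (List.sortedLE_ofFn_iff.2 hf) (List.sortedLE_ofFn_iff.2 hg))

theorem Antitone.eq_of_map_univ_eq {α : Type*} [LinearOrder α] {n : ℕ} {f g : Fin n → α}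
    (hf : Antitone f) (hg : Antitone g)
    (h : Finset.univ.val.map f = Finset.univ.val.map g) : f = g := by
  rw [Fin.univ_val_map, Fin.univ_val_map, Multiset.coe_eq_coe] at h
  exact List.ofFn_injective
    (h.eq_of_sortedGE (List.sortedGE_ofFn_iff.2 hf) (List.sortedGE_ofFn_iff.2 hg))

theorem Monotone.eq_of_card_fiber_eq {α : Type*} [LinearOrder α] {n : ℕ} {f g : Fin n → α}
    (hf : Monotone f) (hg : Monotone g)
    (h : ∀ a, #{x | f x = a} = #{x | g x = a}) : f = g := by
  refine hf.eq_of_map_univ_eq hg (Multiset.ext.2 fun a => ?_)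
  have h' := h a
  rw [Multiset.count_map, Multiset.count_map]
  simpa only [Finset.card_def, Finset.filter_val, eq_comm] using h'

theorem SimpleGraph.IsTree.eq_of_adj_of_dist_add_one_eq {G : SimpleGraph V} (hG : G.IsTree)
    {r v w w' : V} (h : G.Adj w v) (h' : G.Adj w' v) (hd : G.dist r w + 1 = G.dist r v)
    (hd' : G.dist r w' + 1 = G.dist r v) : w = w' := by
  obtain ⟨p, hp⟩ := hG.connected.exists_walk_length_eq_dist w r
  obtain ⟨p', hp'⟩ := hG.connected.exists_walk_length_eq_dist w' r
  rw [G.dist_comm] at hp hp'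
  have hc : (Walk.cons h.symm p).IsPath := by
    apply Walk.isPath_of_length_eq_dist
    rw [Walk.length_cons, hp, hd, G.dist_comm]
  have hc' : (Walk.cons h'.symm p').IsPath := by
    apply Walk.isPath_of_length_eq_dist
    rw [Walk.length_cons, hp', hd', G.dist_comm]
  have := congrArg Subtype.val
    ((hG.isAcyclic.subsingleton_path v r).elim ⟨_, hc⟩ ⟨_, hc'⟩)
  simp only [Walk.cons.injEq] at this
  exact this.1

theorem SimpleGraph.Connected.exists_adj_dist_add_one_eq {G : SimpleGraph V} (hG : G.Connected)
    {r v : V} (h : v ≠ r) : ∃ w, G.Adj w v ∧ G.dist r w + 1 = G.dist r v := by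
  obtain ⟨p, hp⟩ := hG.exists_walk_length_eq_dist v r
  cases p with
  | nil => exact absurd rfl h
  | @cons _ w _ hadj p =>
    refine ⟨w, hadj.symm, ?_⟩
    have h1 := G.dist_le p
    have h2 := hadj.diff_dist_adj (u := r)
    rw [Walk.length_cons, G.dist_comm] at hp
    rw [G.dist_comm] at h1
    omega

/-- In a rooted tree, the neighbor of `v` towards the root, with the root sent to itself. -/
theorem SimpleGraph.IsTree.exists_parent {G : SimpleGraph V} (hG : G.IsTree) (r : V) :
    ∃ par : V → V, par r = r ∧
      (∀ v ≠ r, G.Adj (par v) v ∧ G.dist r (par v) + 1 = G.dist r v) ∧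
      ∀ u v, G.Adj u v ↔ u ≠ v ∧ (par u = v ∨ par v = u) := by
  classical
  choose! f hf using fun v (h : v ≠ r) => hG.connected.exists_adj_dist_add_one_eq h
  have hpar : ∀ v ≠ r, Function.update f r r v = f v := fun v h => Function.update_of_ne h _ _
  refine ⟨Function.update f r r, Function.update_self .., fun v h => hpar v h ▸ hf v h, ?_⟩
  have key : ∀ u v, G.Adj u v → G.dist r u = G.dist r v + 1 → Function.update f r r u = v := by
    intro u v h hd
    have hu : u ≠ r := by
      rintro rfl
      simp at hd
    rw [hpar u hu]
    exact hG.eq_of_adj_of_dist_add_one_eq (hf u hu).1 h.symm (hf u hu).2 hd.symm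
  have key' : ∀ u v, u ≠ v → Function.update f r r u = v → G.Adj u v := by
    intro u v h hp
    by_cases hu : u = r
    · subst hu
      rw [Function.update_self] at hp
      exact absurd hp h
    · rw [hpar u hu] at hp
      exact hp ▸ (hf u hu).1.symm
  intro u v
  constructor
  · intro h
    refine ⟨h.ne, ?_⟩
    rcases hG.dist_eq_dist_add_one_of_adj r h with hd | hd
    · exact .inl (key u v h hd)
    · exact .inr (key v u h.symm hd)
  · rintro ⟨h, hp | hp⟩
    · exact key' u v h hp
    · exact (key' v u h.symm hp).symm

theorem SimpleGraph.card_fiber_parent [Fintype V] [DecidableEq V] {G : SimpleGraph V} {r : V}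
    {par : V → V} (hr : par r = r)
    (hpar : ∀ v ≠ r, G.Adj (par v) v ∧ G.dist r (par v) + 1 = G.dist r v)
    (hadj : ∀ u v, G.Adj u v ↔ u ≠ v ∧ (par u = v ∨ par v = u)) (w : V) :
    #{v | par v = w} = if w = r then deg G w + 1 else deg G w - 1 := by
  classical
  have hdeg : deg G w = #{v | G.Adj w v} := by
    rw [deg, ← G.card_neighborFinset_eq_degree]
    congr 1
    ext v
    simp
  rw [hdeg]
  split_ifs with hw
  · subst hw
    rw [← Finset.card_insert_of_notMem (a := w) (by simp)]
    congr 1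
    ext v
    simp only [mem_filter, mem_univ, true_and, mem_insert, hadj, hr]
    grind
  · have hm : par w ∉ ({v | par v = w} : Finset V) := by
      simp only [mem_filter, mem_univ, true_and]
      intro h
      by_cases hp : par w = r
      · rw [hp, hr] at h
        exact hw h.symm
      · have h1 := (hpar w hw).2
        have h2 := (hpar _ hp).2
        rw [h] at h2
        omega
    have hs : ({v | G.Adj w v} : Finset V) = insert (par w) ({v | par v = w} : Finset V) := by
      ext v
      have := (hpar w hw).1.ne
      simp only [mem_filter, mem_univ, true_and, mem_insert, hadj] at hm ⊢
      grind
    rw [hs, Finset.card_insert_of_notMem hm, Nat.add_sub_cancel]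

/-- A tree with a BFD-ordering is encoded by its degree function and its parent function,
both read along the ordering. -/
theorem IsBFDOrdering.exists_encoding [Fintype V] [Nonempty V] {G : SimpleGraph V}
    (hG : G.IsTree) {ord : V ≃ Fin (Fintype.card V)} (hord : IsBFDOrdering G ord)
    {n : ℕ} (hn : Fintype.card V = n) :
    ∃ (e : V ≃ Fin n) (D : Fin n → ℕ) (P : Fin n → Fin n),
      Antitone D ∧ Monotone P ∧ Finset.univ.val.map D = degMultiset G ∧
      (∀ i, #{j | P j = i} = if i.val = 0 then D i + 1 else D i - 1) ∧
      ∀ u v, G.Adj u v ↔ e u ≠ e v ∧ (P (e u) = e v ∨ P (e v) = e u) := by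
  classical
  subst hn
  obtain ⟨-, hB1, hB2⟩ := hord
  obtain ⟨r, hr0⟩ : ∃ r, r = ord.symm ⟨0, Fintype.card_pos⟩ := ⟨_, rfl⟩
  have hord0 : ord r = ⟨0, Fintype.card_pos⟩ := by simp [hr0]
  obtain ⟨par, hr, hpar, hadj⟩ := hG.exists_parent r
  have hisPar : ∀ v ≠ r, IsParent G ord (par v) v := by
    intro v hv
    rw [IsParent, ← hr0]
    refine ⟨(hpar v hv).1, (hpar v hv).2, fun w' h1 h2 => ?_⟩
    rw [hG.eq_of_adj_of_dist_add_one_eq (hpar v hv).1 h1 (hpar v hv).2 h2]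
  refine ⟨ord, fun i => deg G (ord.symm i), fun i => ord (par (ord.symm i)), ?_, ?_, ?_, ?_, ?_⟩
  · intro i j hij
    rcases hij.eq_or_lt with rfl | hij
    · exact le_rfl
    · exact hB2 _ _ (by simpa using hij)
  · intro i j hij
    by_contra! hlt
    have hi : ord.symm i ≠ r := by
      intro h
      simp [h, hr, hord0] at hlt
    have hj : ord.symm j ≠ r := by
      intro h
      rw [Equiv.symm_apply_eq, hord0] at h
      refine hi ?_
      rw [Equiv.symm_apply_eq, hord0]
      exact Fin.ext (by simpa [h, Fin.le_def] using hij)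
    have := hB1 _ _ _ _ hlt (hisPar _ hj) (hisPar _ hi)
    simp only [Equiv.apply_symm_apply] at this
    exact this.not_ge hij
  · rw [degMultiset, ← Function.comp_def, ← Multiset.map_map]
    congr 1
    exact congrArg Finset.val (Finset.map_univ_equiv ord.symm)
  · intro i
    have h := SimpleGraph.card_fiber_parent hr hpar hadj (ord.symm i)
    have hi : ord.symm i = r ↔ i.val = 0 := by
      rw [Equiv.symm_apply_eq, hord0, Fin.ext_iff]
    simp only [hi] at h
    rw [← h]
    refine Finset.card_equiv ord.symm fun j => ?_
    simp [Equiv.eq_symm_apply]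
  · intro u v
    simp [hadj]

/-- Two trees with the same degree sequence that both admit a
BFD-ordering are isomorphic. -/
theorem bfd_tree_unique [Fintype V] [DecidableEq V] [Nonempty V]
    [Fintype W] [DecidableEq W] [Nonempty W]
    (G : SimpleGraph V) (H : SimpleGraph W) (hG : G.IsTree) (hH : H.IsTree)
    (hdeg : degMultiset G = degMultiset H)
    (hGbfd : ∃ ord : V ≃ Fin (Fintype.card V), IsBFDOrdering G ord)
    (hHbfd : ∃ ord : W ≃ Fin (Fintype.card W), IsBFDOrdering H ord) :
    Nonempty (G ≃g H) := by
  obtain ⟨ordG, hordG⟩ := hGbfd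
  obtain ⟨ordH, hordH⟩ := hHbfd
  have hcard : Fintype.card W = Fintype.card V := by
    simpa [degMultiset] using (congrArg Multiset.card hdeg).symm
  obtain ⟨e, D, P, hD, hP, hDG, hPD, hadj⟩ := hordG.exists_encoding hG rfl
  obtain ⟨e', D', P', hD', hP', hDH, hPD', hadj'⟩ := hordH.exists_encoding hH hcard
  obtain rfl : D = D' := hD.eq_of_map_univ_eq hD' (by rw [hDG, hDH, hdeg])
  obtain rfl : P = P' := hP.eq_of_card_fiber_eq hP' fun i => by rw [hPD, hPD']
  exact ⟨⟨e.trans e'.symm, by intro u v; simp [hadj, hadj']⟩⟩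
end
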